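/- Let μ, ν be partitions and s ∈ ℤ². Then the pole order of T_{μ*ν}(u) at u = [s] satisfies 1 − max(|O_μ|, |O_ν|) ≤ ord_{u=[s]} T_{μ*ν}(u) ≤ 1; in particular, every pole of T_{μ*ν} is simple. -/

import Mathlib

/-!
Common setup: boxes, Young diagrams as finite lower sets of boxes (French notation),
arms, legs, hooks, the field `ℚ(α)`, rational functions in `u` over `ℚ(α)`,
the functions `T_Γ`, corners, star products, rectangles and complements.
-/

open scoped BigOperators

attribute [local instance] Classical.propDecidable

namespace JackLR

/-- A box `(x, y)`: `x` is the column index, `y` the row index (French notation). -/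
abbrev Box := ℕ × ℕ

/-- The field `ℚ(α)`. -/
abbrev K := RatFunc ℚ

/-- Rational functions in a variable `u` with coefficients in `ℚ(α)`. -/
abbrev F := RatFunc K

/-- The indeterminate `α`. -/
noncomputable def alpha : K := RatFunc.X

/-- `[c] := α·x − y` for `c = (x, y) ∈ ℤ²`. -/
noncomputable def brk (c : ℤ × ℤ) : K := alpha * (c.1 : K) - (c.2 : K)

/-- The embedding of a box into `ℤ²`. -/
def zb (b : Box) : ℤ × ℤ := ((b.1 : ℤ), (b.2 : ℤ))

/-- `[b]` for a box `b`. -/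
noncomputable def brkN (b : Box) : K := brk (zb b)

/-- `S` is the set of boxes of a Young diagram (equivalently, of a partition). -/
def IsYoung (S : Finset Box) : Prop := IsLowerSet (↑S : Set Box)

/-- The arm of `s`: number of boxes of `S` strictly to the right of `s` in its row. -/
def arm (S : Finset Box) (s : Box) : ℕ := (S.filter fun b => b.2 = s.2 ∧ s.1 < b.1).card

/-- The leg of `s`: number of boxes of `S` strictly above `s` in its column. -/
def leg (S : Finset Box) (s : Box) : ℕ := (S.filter fun b => b.1 = s.1 ∧ s.2 < b.2).card

/-- Upper hook vector `h⁺_S(s) = (arm+1, −leg)`. -/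
def hup (S : Finset Box) (s : Box) : ℤ × ℤ := ((arm S s : ℤ) + 1, -(leg S s : ℤ))

/-- Lower hook vector `h⁻_S(s) = (arm, −leg−1)`. -/
def hlo (S : Finset Box) (s : Box) : ℤ × ℤ := ((arm S s : ℤ), -((leg S s : ℤ) + 1))

/-- Upper hook value `uh_S(s) = α(arm+1) + leg`. -/
noncomputable def uh (S : Finset Box) (s : Box) : K := brk (hup S s)

/-- Lower hook value `lh_S(s) = α·arm + leg + 1`. -/
noncomputable def lh (S : Finset Box) (s : Box) : K := brk (hlo S s)

/-- The variable `u`. -/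
noncomputable def uu : F := RatFunc.X

/-- `T_□(w) = (w−[0,0])(w−[1,1]) / ((w−[1,0])(w−[0,1]))`. -/
noncomputable def Tbox (w : F) : F :=
  ((w - RatFunc.C (brk (0, 0))) * (w - RatFunc.C (brk (1, 1)))) /
    ((w - RatFunc.C (brk (1, 0))) * (w - RatFunc.C (brk (0, 1))))

/-- `T_Γ` with the variable `u` replaced by `w`. -/
noncomputable def TMat (Γ : Multiset Box) (w : F) : F :=
  (Γ.map fun b => Tbox (w - RatFunc.C (brkN b))).prod

/-- `T_Γ(u) = ∏_{b ∈ Γ} T_□(u − [b])` for a finite multiset `Γ` of boxes. -/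
noncomputable def TM (Γ : Multiset Box) : F := TMat Γ uu

/-- `T_S(u)` for a finite set `S` of boxes. -/
noncomputable def TS (S : Finset Box) : F := TM S.val

/-- The star product `μ * ν` as the multiset `{s + t : s ∈ μ, t ∈ ν}` with multiplicity. -/
def star (μ ν : Finset Box) : Multiset Box :=
  μ.val.bind fun s => ν.val.map fun t => (s.1 + t.1, s.2 + t.2)

/-- The rectangular partition `m^n` (n rows of length m). -/
def rect (m n : ℕ) : Finset Box := Finset.range m ×ˢ Finset.range n

/-- `v⁻ = (m−1, n−1)`. -/
def vminus (m n : ℕ) : Box := (m - 1, n - 1)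

/-- `b̄ := v⁻ − b`. -/
def conjBox (m n : ℕ) (b : Box) : Box := (m - 1 - b.1, n - 1 - b.2)

/-- The complement partition of `μ ⊆ m^n` inside `m^n`, with boxes `{v⁻ − b : b ∈ m^n, b ∉ μ}`. -/
def complIn (m n : ℕ) (μ : Finset Box) : Finset Box := (rect m n \ μ).image (conjBox m n)

/-- `b̂ := (m−1−b₁, b₂)`. -/
def hflip (m : ℕ) (b : Box) : Box := (m - 1 - b.1, b.2)

/-- `b̌ := (b₁, n−1−b₂)`. -/
def vflip (n : ℕ) (b : Box) : Box := (b.1, n - 1 - b.2)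

/-- Inner corners `I_S`: removable boxes. -/
def Inner (S : Finset Box) : Finset Box :=
  S.filter fun s => (s.1 + 1, s.2) ∉ S ∧ (s.1, s.2 + 1) ∉ S

/-- `t` can be added to `S` to give again a Young diagram. -/
def addable (S : Finset Box) (t : Box) : Prop :=
  t ∉ S ∧ (t.1 = 0 ∨ (t.1 - 1, t.2) ∈ S) ∧ (t.2 = 0 ∨ (t.1, t.2 - 1) ∈ S)

/-- Outer corners `O_S`: addable boxes (these all satisfy the bounds used below). -/
noncomputable def Outer (S : Finset Box) : Finset Box :=
  ((Finset.range (S.sup Prod.fst + 2)) ×ˢ (Finset.range (S.sup Prod.snd + 2))).filter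
    fun t => addable S t

/-- `I⁺_S = {s + (1,1) : s ∈ I_S}`. -/
noncomputable def Iplus (S : Finset Box) : Finset Box :=
  (Inner S).image fun s => (s.1 + 1, s.2 + 1)

/-- `R^s_S` : boxes of `S` in the same row as `s`. -/
def rowOf (S : Finset Box) (s : Box) : Finset Box := S.filter fun b => b.2 = s.2

/-- `C^s_S` : boxes of `S` in the same column as `s`. -/
def colOf (S : Finset Box) (s : Box) : Finset Box := S.filter fun b => b.1 = s.1

/-- `a ∧ b := (min a₁ b₁, min a₂ b₂)`. -/
def meet (a b : Box) : Box := (min a.1 b.1, min a.2 b.2)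

/-- Pole order of `f` at `u = c`: multiplicity of `(u − c)` in the denominator minus its
multiplicity in the numerator, `f` being written in lowest terms. -/
noncomputable def polOrder (f : F) (c : K) : ℤ :=
  (f.denom.rootMultiplicity c : ℤ) - (f.num.rootMultiplicity c : ℤ)

/-- `ϖ_S = ∏_{b ∈ S, b ≠ (0,0)} [b]`. -/
noncomputable def varpi (S : Finset Box) : K := ∏ b ∈ S.erase (0, 0), brkN b

/-! ### Pole orders -/

theorem polOrder_div (p q : Polynomial K) (hp : p ≠ 0) (hq : q ≠ 0) (c : K) :
    polOrder (algebraMap (Polynomial K) F p / algebraMap (Polynomial K) F q) c =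
      (q.rootMultiplicity c : ℤ) - (p.rootMultiplicity c : ℤ) := by
  set f : F := algebraMap (Polynomial K) F p / algebraMap (Polynomial K) F q with hf
  have hf0 : f ≠ 0 := div_ne_zero (RatFunc.algebraMap_ne_zero hp) (RatFunc.algebraMap_ne_zero hq)
  have h : f.num * q = p * f.denom := by
    have hdiv := (RatFunc.num_div_denom f).trans hf
    rw [div_eq_div_iff (RatFunc.algebraMap_ne_zero f.denom_ne_zero)
      (RatFunc.algebraMap_ne_zero hq), ← map_mul, ← map_mul] at hdiv
    exact RatFunc.algebraMap_injective K hdiv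
  have hmul := congrArg (Polynomial.rootMultiplicity c) h
  rw [Polynomial.rootMultiplicity_mul (mul_ne_zero (RatFunc.num_ne_zero hf0) hq),
    Polynomial.rootMultiplicity_mul (mul_ne_zero hp f.denom_ne_zero)] at hmul
  unfold polOrder
  omega

theorem polOrder_mul {f g : F} (hf : f ≠ 0) (hg : g ≠ 0) (c : K) :
    polOrder (f * g) c = polOrder f c + polOrder g c := by
  have hfn := RatFunc.num_ne_zero hf
  have hgn := RatFunc.num_ne_zero hg
  have h : f * g = algebraMap (Polynomial K) F (f.num * g.num) /
      algebraMap (Polynomial K) F (f.denom * g.denom) := by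
    conv_lhs => rw [← RatFunc.num_div_denom f, ← RatFunc.num_div_denom g]
    rw [map_mul, map_mul, div_mul_div_comm]
  rw [h, polOrder_div _ _ (mul_ne_zero hfn hgn) (mul_ne_zero f.denom_ne_zero g.denom_ne_zero),
    Polynomial.rootMultiplicity_mul (mul_ne_zero hfn hgn),
    Polynomial.rootMultiplicity_mul (mul_ne_zero f.denom_ne_zero g.denom_ne_zero)]
  unfold polOrder
  push_cast
  ring

theorem polOrder_one (c : K) : polOrder 1 c = 0 := by
  simp [polOrder, Polynomial.rootMultiplicity_eq_zero, Polynomial.IsRoot]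

theorem polOrder_multiset_prod (m : Multiset F) (hm : ∀ f ∈ m, f ≠ 0) (c : K) :
    polOrder m.prod c = (m.map fun f => polOrder f c).sum := by
  induction m using Multiset.induction_on with
  | empty => simp [polOrder_one]
  | cons f m ih =>
    have hm' : ∀ g ∈ m, g ≠ 0 := fun g hg => hm g (Multiset.mem_cons_of_mem hg)
    rw [Multiset.prod_cons, Multiset.map_cons, Multiset.sum_cons, ← ih hm',
      polOrder_mul (hm f (Multiset.mem_cons_self f m))
        (Multiset.prod_ne_zero fun h => hm' 0 h rfl)]

theorem brk_add (a b : ℤ × ℤ) : brk (a + b) = brk a + brk b := by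
  simp only [brk, Prod.fst_add, Prod.snd_add]
  push_cast
  ring

theorem brk_injective : Function.Injective brk := by
  intro a b h
  have hpoly (c : ℤ × ℤ) : brk c = algebraMap (Polynomial ℚ) K
      (Polynomial.X * Polynomial.C (c.1 : ℚ) - Polynomial.C (c.2 : ℚ)) := by
    simp [brk, alpha]
  rw [hpoly, hpoly] at h
  have h' := RatFunc.algebraMap_injective ℚ h
  have h0 := congrArg (fun p => Polynomial.coeff p 0) h'
  have h1 := congrArg (fun p => Polynomial.coeff p 1) h'
  simp only [Polynomial.coeff_sub, Polynomial.coeff_mul_C, Polynomial.coeff_X_zero,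
    Polynomial.coeff_X_one, Polynomial.coeff_C_zero, Polynomial.coeff_C_succ, zero_mul, one_mul,
    zero_sub, sub_zero, neg_inj, Int.cast_inj] at h0 h1
  exact Prod.ext h1 h0

/-- The contribution of a box at the origin to the pole order at a point `z`. -/
noncomputable def boxOrder (z : ℤ × ℤ) : ℤ :=
  (if (1, 0) = z then 1 else 0) + (if (0, 1) = z then 1 else 0)
    - (if (0, 0) = z then 1 else 0) - (if (1, 1) = z then 1 else 0)

theorem Tbox_sub_eq (b : Box) :
    Tbox (uu - RatFunc.C (brkN b)) =
      algebraMap (Polynomial K) F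
        ((Polynomial.X - Polynomial.C (brk (zb b + (0, 0)))) *
          (Polynomial.X - Polynomial.C (brk (zb b + (1, 1))))) /
      algebraMap (Polynomial K) F
        ((Polynomial.X - Polynomial.C (brk (zb b + (1, 0)))) *
          (Polynomial.X - Polynomial.C (brk (zb b + (0, 1))))) := by
  simp only [Tbox, uu, brkN, brk_add, map_mul, map_sub, map_add, RatFunc.algebraMap_X,
    RatFunc.algebraMap_C, sub_sub]

theorem X_sub_C_mul_ne_zero (a b : K) :
    (Polynomial.X - Polynomial.C a) * (Polynomial.X - Polynomial.C b) ≠ 0 :=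
  mul_ne_zero (Polynomial.X_sub_C_ne_zero a) (Polynomial.X_sub_C_ne_zero b)

theorem Tbox_sub_ne_zero (b : Box) : Tbox (uu - RatFunc.C (brkN b)) ≠ 0 := by
  rw [Tbox_sub_eq]
  exact div_ne_zero (RatFunc.algebraMap_ne_zero (X_sub_C_mul_ne_zero _ _))
    (RatFunc.algebraMap_ne_zero (X_sub_C_mul_ne_zero _ _))

theorem polOrder_Tbox_sub (b : Box) (s : ℤ × ℤ) :
    polOrder (Tbox (uu - RatFunc.C (brkN b))) (brk s) = boxOrder (s - zb b) := by
  have hif (d : ℤ × ℤ) : (if brk s = brk (zb b + d) then (1 : ℤ) else 0) =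
      if d = s - zb b then 1 else 0 := by
    congr 1
    rw [brk_injective.eq_iff, eq_sub_iff_add_eq', @eq_comm _ s]
  rw [Tbox_sub_eq, polOrder_div _ _ (X_sub_C_mul_ne_zero _ _) (X_sub_C_mul_ne_zero _ _),
    Polynomial.rootMultiplicity_mul (X_sub_C_mul_ne_zero _ _),
    Polynomial.rootMultiplicity_mul (X_sub_C_mul_ne_zero _ _)]
  simp only [Polynomial.rootMultiplicity_X_sub_C, Nat.cast_add, Nat.cast_ite, Nat.cast_one,
    Nat.cast_zero, hif, boxOrder]
  ring

theorem polOrder_TM_star (μ ν : Finset Box) (s : ℤ × ℤ) :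
    polOrder (TM (star μ ν)) (brk s) = ∑ b ∈ ν, ∑ a ∈ μ, boxOrder (s - zb b - zb a) := by
  rw [Finset.sum_comm, TM, TMat, polOrder_multiset_prod _ (by
    intro f hf
    obtain ⟨b, -, rfl⟩ := Multiset.mem_map.1 hf
    exact Tbox_sub_ne_zero b)]
  simp only [Multiset.map_map, Function.comp_def, polOrder_Tbox_sub, star, Multiset.map_bind,
    Multiset.sum_bind, Finset.sum]
  congr 1
  refine Multiset.map_congr rfl fun a _ => ?_
  congr 1
  refine Multiset.map_congr rfl fun b _ => ?_
  congr 1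
  ext <;> simp [zb] <;> ring

/-! ### Corners of a Young diagram -/

theorem zb_injective : Function.Injective zb := by
  rintro ⟨a, b⟩ ⟨c, d⟩ h
  simpa [zb] using h

theorem mem_Outer {S : Finset Box} {t : Box} : t ∈ Outer S ↔ addable S t := by
  refine ⟨fun h => (Finset.mem_filter.1 h).2, fun h => Finset.mem_filter.2 ⟨?_, h⟩⟩
  obtain ⟨-, h1, h2⟩ := h
  simp only [Finset.mem_product, Finset.mem_range]
  constructor
  · rcases h1 with h1 | h1
    · omega
    · have := Finset.le_sup (f := Prod.fst) h1
      simp only at this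
      omega
  · rcases h2 with h2 | h2
    · omega
    · have := Finset.le_sup (f := Prod.snd) h2
      simp only at this
      omega

theorem mem_Iplus {S : Finset Box} {t : Box} :
    t ∈ Iplus S ↔ 0 < t.1 ∧ 0 < t.2 ∧ (t.1 - 1, t.2 - 1) ∈ S ∧ (t.1, t.2 - 1) ∉ S ∧
      (t.1 - 1, t.2) ∉ S := by
  obtain ⟨x, y⟩ := t
  simp only [Iplus, Inner, Finset.mem_image, Finset.mem_filter]
  constructor
  · rintro ⟨⟨a, b⟩, ⟨h1, h2, h3⟩, h⟩
    obtain ⟨rfl, rfl⟩ := Prod.mk.inj h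
    simp_all
  · rintro ⟨hx, hy, h1, h2, h3⟩
    obtain ⟨x, rfl⟩ := Nat.exists_eq_add_of_lt hx
    obtain ⟨y, rfl⟩ := Nat.exists_eq_add_of_lt hy
    exact ⟨(x, y), by simp_all, by simp⟩

theorem IsYoung.mem_of_le {S : Finset Box} (hS : IsYoung S) {a b c d : ℕ} (h : (a, b) ∈ S)
    (hc : c ≤ a) (hd : d ≤ b) : (c, d) ∈ S :=
  hS (Prod.mk_le_mk.2 ⟨hc, hd⟩) h

theorem sum_ite_zb (S : Finset Box) (z : ℤ × ℤ) :
    (∑ a ∈ S, if zb a = z then (1 : ℤ) else 0) = if z ∈ S.image zb then 1 else 0 := by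
  by_cases hz : z ∈ S.image zb
  · obtain ⟨a, ha, rfl⟩ := Finset.mem_image.1 hz
    simp [zb_injective.eq_iff, ha]
  · rw [if_neg hz]
    exact Finset.sum_eq_zero fun a ha =>
      if_neg fun h => hz (Finset.mem_image.2 ⟨a, ha, h⟩)

theorem sum_boxOrder (S : Finset Box) (z : ℤ × ℤ) :
    ∑ a ∈ S, boxOrder (z - zb a) =
      (if z - (1, 0) ∈ S.image zb then 1 else 0) + (if z - (0, 1) ∈ S.image zb then 1 else 0)
        - (if z ∈ S.image zb then 1 else 0) - (if z - (1, 1) ∈ S.image zb then 1 else 0) := by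
  have h (d : ℤ × ℤ) : (∑ a ∈ S, if d = z - zb a then (1 : ℤ) else 0) =
      if z - d ∈ S.image zb then 1 else 0 := by
    rw [← sum_ite_zb]
    refine Finset.sum_congr rfl fun a _ => ?_
    congr 1
    rw [eq_sub_iff_add_eq', eq_sub_iff_add_eq]
  simp only [boxOrder, Finset.sum_add_distrib, Finset.sum_sub_distrib, h,
    Prod.mk_zero_zero, sub_zero]

theorem mem_image_zb {S : Finset Box} {z : ℤ × ℤ} :
    z ∈ S.image zb ↔ 0 ≤ z.1 ∧ 0 ≤ z.2 ∧ (z.1.toNat, z.2.toNat) ∈ S := by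
  obtain ⟨x, y⟩ := z
  simp only [Finset.mem_image, zb, Prod.exists, Prod.mk.injEq]
  constructor
  · rintro ⟨a, b, h, rfl, rfl⟩
    simpa using h
  · rintro ⟨hx, hy, h⟩
    exact ⟨_, _, h, Int.toNat_of_nonneg hx, Int.toNat_of_nonneg hy⟩

/-- The pole order of `T_S` is `1` on outer corners, `-1` on shifted inner corners, with a
correction at the origin. -/
theorem sum_boxOrder_eq_corners {S : Finset Box} (hS : IsYoung S) (z : ℤ × ℤ) :
    ∑ a ∈ S, boxOrder (z - zb a) =
      (∑ o ∈ Outer S, if zb o = z then (1 : ℤ) else 0)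
        - (∑ i ∈ Iplus S, if zb i = z then (1 : ℤ) else 0) - (if z = 0 then 1 else 0) := by
  rw [sum_boxOrder, sum_ite_zb, sum_ite_zb]
  obtain ⟨x, y⟩ := z
  simp only [mem_image_zb, mem_Outer, mem_Iplus, addable, Prod.fst_sub, Prod.snd_sub,
    Prod.mk_eq_zero]
  by_cases hx : 0 ≤ x
  swap
  · have h1 : ¬ 1 ≤ x := by omega
    have h2 : x ≠ 0 := by omega
    simp [hx, h1, h2]
  by_cases hy : 0 ≤ y
  swap
  · have h1 : ¬ 1 ≤ y := by omega
    have h2 : y ≠ 0 := by omega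
    simp [hy, h1, h2]
  lift x to ℕ using hx
  lift y to ℕ using hy
  have hleft : (x, y) ∈ S → (x - 1, y) ∈ S := fun h => hS.mem_of_le h (by omega) le_rfl
  have hdown : (x, y) ∈ S → (x, y - 1) ∈ S := fun h => hS.mem_of_le h le_rfl (by omega)
  have hl : (x - 1, y) ∈ S → (x - 1, y - 1) ∈ S := fun h => hS.mem_of_le h le_rfl (by omega)
  have hd : (x, y - 1) ∈ S → (x - 1, y - 1) ∈ S := fun h => hS.mem_of_le h (by omega) le_rfl
  rcases x with _ | x <;> rcases y with _ | y <;> simp at hleft hdown hl hd ⊢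
  · split_ifs <;> simp_all
  · have e1 : (0 : ℤ) ≤ (y : ℤ) + 1 := by omega
    have e2 : ¬ ((y : ℤ) + 1 = 0) := by omega
    simp only [e1, e2]
    split_ifs <;> simp_all
  · have e1 : (0 : ℤ) ≤ (x : ℤ) + 1 := by omega
    have e2 : ¬ ((x : ℤ) + 1 = 0) := by omega
    simp only [e1, e2]
    split_ifs <;> simp_all
  · have e1 : (0 : ℤ) ≤ (x : ℤ) + 1 := by omega
    have e2 : (0 : ℤ) ≤ (y : ℤ) + 1 := by omega
    have e3 : ¬ ((x : ℤ) + 1 = 0) := by omega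
    simp only [e1, e2, e3]
    split_ifs <;> simp_all

theorem exists_column_height {S : Finset Box} (hS : IsYoung S) (x : ℕ) :
    ∃ h, ∀ y, (x, y) ∈ S ↔ y < h := by
  have hex : ∃ y, (x, y) ∉ S := by
    by_contra! hall
    have := Finset.le_sup (f := Prod.snd) (hall (S.sup Prod.snd + 1))
    simp only at this
    omega
  refine ⟨Nat.find hex, fun y => ⟨fun hy => ?_, fun hy => not_not.1 (Nat.find_min hex hy)⟩⟩
  by_contra! hle
  exact Nat.find_spec hex (hS.mem_of_le hy le_rfl hle)

theorem exists_row_length {S : Finset Box} (hS : IsYoung S) (y : ℕ) :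
    ∃ w, ∀ x, (x, y) ∈ S ↔ x < w := by
  have hex : ∃ x, (x, y) ∉ S := by
    by_contra! hall
    have := Finset.le_sup (f := Prod.fst) (hall (S.sup Prod.fst + 1))
    simp only at this
    omega
  refine ⟨Nat.find hex, fun x => ⟨fun hx => ?_, fun hx => not_not.1 (Nat.find_min hex hx)⟩⟩
  by_contra! hle
  exact Nat.find_spec hex (hS.mem_of_le hx hle le_rfl)

theorem card_Iplus_lt_card_Outer {S : Finset Box} (hS : IsYoung S) :
    (Iplus S).card < (Outer S).card := by
  choose h hh using exists_column_height hS
  have hmem : (0, h 0) ∈ Outer S := by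
    refine mem_Outer.2 ⟨by simp [hh], Or.inl rfl, ?_⟩
    simp only [hh]
    omega
  have hle : (Iplus S).card ≤ ((Outer S).erase (0, h 0)).card := by
    refine Finset.card_le_card_of_injOn (fun i => (i.1, h i.1)) ?_ ?_
    · rintro ⟨x, y⟩ hi
      obtain ⟨hx, hy, h1, h2, h3⟩ := mem_Iplus.1 hi
      refine Finset.mem_erase.2 ⟨by simp; omega, mem_Outer.2 ⟨by simp [hh], Or.inr ?_, ?_⟩⟩
      · simp only [hh] at *
        omega
      · simp only [hh]
        omega
    · rintro ⟨x, y⟩ hi ⟨x', y'⟩ hi' heq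
      obtain ⟨hx, hy, h1, h2, h3⟩ := mem_Iplus.1 hi
      obtain ⟨hx', hy', h1', h2', h3'⟩ := mem_Iplus.1 hi'
      obtain ⟨rfl, -⟩ := Prod.mk.inj heq
      simp only [hh] at *
      ext <;> simp only
      omega
  have := Finset.card_erase_lt_of_mem hmem
  omega

theorem one_lt_card_Outer {S : Finset Box} (hS : IsYoung S) (hne : S.Nonempty) :
    1 < (Outer S).card := by
  obtain ⟨⟨x, y⟩, hxy⟩ := hne
  have h0 : (0, 0) ∈ S := hS.mem_of_le hxy (Nat.zero_le x) (Nat.zero_le y)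
  obtain ⟨h, hh⟩ := exists_column_height hS 0
  obtain ⟨w, hw⟩ := exists_row_length hS 0
  have hpos := (hh 0).1 h0
  refine Finset.one_lt_card.2 ⟨(0, h), mem_Outer.2 ⟨by simp [hh], Or.inl rfl, ?_⟩,
    (w, 0), mem_Outer.2 ⟨by simp [hw], ?_, Or.inl rfl⟩, ?_⟩
  · simp only [hh]
    omega
  · simp only [hw]
    omega
  · simp only [ne_eq, Prod.mk.injEq]
    omega

/-- In a region below `s` that is upward closed, consecutive outer corners are separated by shifted
inner corners. -/
theorem card_filter_Outer_le {S : Finset Box} (hS : IsYoung S) (A : Set Box) (s : Box)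
    (hle : ∀ a ∈ A, a ≤ s) (hup : ∀ a ∈ A, ∀ b, a ≤ b → b ≤ s → b ∈ A) :
    ((Outer S).filter (· ∈ A)).card ≤ ((Iplus S).filter (· ∈ A)).card + 1 := by
  rcases ((Outer S).filter (· ∈ A)).eq_empty_or_nonempty with he | hne
  · simp [he]
  obtain ⟨⟨a', b'⟩, ho', hmax⟩ := Finset.exists_max_image _ Prod.fst hne
  choose w hw using exists_row_length hS
  rw [← Nat.sub_le_iff_le_add, ← Finset.card_erase_of_mem ho']
  obtain ⟨hO', hA'⟩ := Finset.mem_filter.1 ho'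
  obtain ⟨hn', hl', hd'⟩ := mem_Outer.1 hO'
  have hles := hle _ hA'
  have key : ∀ a b, (a, b) ∈ ((Outer S).filter (· ∈ A)).erase (a', b') →
      (a, b) ∈ A ∧ 0 < b ∧ w b ≤ a ∧ a < w (b - 1) ∧ w (b - 1) ≤ a' ∧ (a = 0 ∨ a - 1 < w b) := by
    intro a b ho
    obtain ⟨hne', hmem⟩ := Finset.mem_erase.1 ho
    obtain ⟨hO, hA⟩ := Finset.mem_filter.1 hmem
    obtain ⟨hn, hl, hd⟩ := mem_Outer.1 hO
    have haa := hmax _ hmem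
    simp only at haa hn hl hd hn' hl' hd'
    have hbb : b' < b := by
      by_contra! hbb
      rcases haa.lt_or_eq with hlt | rfl
      · exact hn (hS.mem_of_le (hl'.resolve_left (by omega)) (by omega) hbb)
      · have hlt : b < b' := lt_of_le_of_ne hbb fun h => hne' (by rw [h])
        exact hn (hS.mem_of_le (hd'.resolve_left (by omega)) le_rfl (by omega))
    refine ⟨hA, by omega, ?_, ?_, ?_, ?_⟩
    · simpa [hw] using hn
    · exact (hw _ _).1 (hd.resolve_left (by omega))
    · by_contra! hlt
      exact hn' (hS.mem_of_le ((hw _ _).2 hlt) le_rfl (by omega))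
    · simpa only [hw] using hl
  refine Finset.card_le_card_of_injOn (fun o => (w (o.2 - 1), o.2)) ?_ ?_
  · rintro ⟨a, b⟩ ho
    obtain ⟨hA, hb, h1, h2, h3, -⟩ := key a b ho
    refine Finset.mem_filter.2 ⟨mem_Iplus.2 ?_, ?_⟩
    · simp only [hw]
      omega
    · exact hup _ hA _ ⟨h2.le, le_rfl⟩ ⟨h3.trans hles.1, (hle _ hA).2⟩
  · rintro ⟨a, b⟩ ho ⟨c, d⟩ ho' heq
    obtain ⟨-, rfl⟩ := Prod.mk.inj heq
    obtain ⟨-, hb, h1, h2, h3, h4⟩ := key _ _ ho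
    obtain ⟨-, hb', h1', h2', h3', h4'⟩ := key _ _ ho'
    ext <;> simp only at *
    omega

/-! ### Pole orders of star products -/

/-- The points `s - t` with `t ∈ ν`, as boxes. -/
def reflected (ν : Finset Box) (s : ℤ × ℤ) : Set Box := {b | s - zb b ∈ ν.image zb}

theorem sum_sum_ite_zb (O ν : Finset Box) (s : ℤ × ℤ) :
    (∑ b ∈ ν, ∑ o ∈ O, if zb o = s - zb b then (1 : ℤ) else 0) =
      (O.filter (· ∈ reflected ν s)).card := by
  rw [Finset.sum_comm, Finset.card_filter]
  push_cast
  refine Finset.sum_congr rfl fun o _ => ?_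
  trans ∑ b ∈ ν, if zb b = s - zb o then (1 : ℤ) else 0
  · refine Finset.sum_congr rfl fun b _ => ?_
    congr 1
    rw [eq_sub_iff_add_eq', eq_sub_iff_add_eq]
  · rw [sum_ite_zb]
    congr 1

theorem polOrder_TM_star_eq_corners {μ : Finset Box} (hμ : IsYoung μ) (ν : Finset Box)
    (s : ℤ × ℤ) :
    polOrder (TM (star μ ν)) (brk s) =
      ((Outer μ).filter (· ∈ reflected ν s)).card - ((Iplus μ).filter (· ∈ reflected ν s)).card
        - (if s ∈ ν.image zb then 1 else 0) := by
  rw [polOrder_TM_star]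
  simp only [sum_boxOrder_eq_corners hμ, Finset.sum_sub_distrib, sum_sum_ite_zb]
  rw [← sum_ite_zb]
  simp only [sub_eq_zero, eq_comm]

theorem star_comm (μ ν : Finset Box) : star μ ν = star ν μ := by
  simp only [star]
  rw [Multiset.bind_map_comm]
  simp only [add_comm]

theorem polOrder_TM_star_le_one {μ ν : Finset Box} (hμ : IsYoung μ) (hν : IsYoung ν)
    (s : ℤ × ℤ) : polOrder (TM (star μ ν)) (brk s) ≤ 1 := by
  have h := card_filter_Outer_le hμ (reflected ν s) (s.1.toNat, s.2.toNat)
    (by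
      rintro ⟨a, b⟩ h
      obtain ⟨h1, h2, -⟩ := mem_image_zb.1 h
      simp only [zb, Prod.fst_sub, Prod.snd_sub] at h1 h2
      exact ⟨by simp only; omega, by simp only; omega⟩)
    (by
      rintro ⟨a, b⟩ h ⟨c, d⟩ ⟨hac, hbd⟩ ⟨hc, hd⟩
      obtain ⟨h1, h2, h3⟩ := mem_image_zb.1 h
      simp only [zb, Prod.fst_sub, Prod.snd_sub] at h1 h2 h3 hac hbd hc hd
      refine mem_image_zb.2 ⟨?_, ?_, hν.mem_of_le h3 ?_ ?_⟩ <;>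
        simp only [zb, Prod.fst_sub, Prod.snd_sub] <;> omega)
  rw [polOrder_TM_star_eq_corners hμ]
  split_ifs <;> omega

theorem one_sub_card_Outer_le_polOrder {μ ν : Finset Box} (hμ : IsYoung μ) (s : ℤ × ℤ)
    (hs : s ∉ ν.image zb) :
    1 - ((Outer μ).card : ℤ) ≤ polOrder (TM (star μ ν)) (brk s) := by
  rw [polOrder_TM_star_eq_corners hμ, if_neg hs]
  have h1 := card_Iplus_lt_card_Outer hμ
  have h2 := Finset.card_filter_le (Iplus μ) (· ∈ reflected ν s)
  omega

theorem neg_one_le_polOrder_of_mem {μ : Finset Box} (hμ : IsYoung μ) (ν : Finset Box)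
    (s : ℤ × ℤ) (hs : s ∈ μ.image zb) :
    -1 ≤ polOrder (TM (star μ ν)) (brk s) := by
  have he : (Iplus μ).filter (· ∈ reflected ν s) = ∅ := by
    refine Finset.filter_eq_empty_iff.2 ?_
    rintro ⟨x, y⟩ hi hA
    obtain ⟨-, -, -, hn, -⟩ := mem_Iplus.1 hi
    obtain ⟨h1, h2, -⟩ := mem_image_zb.1 hA
    obtain ⟨h3, h4, h5⟩ := mem_image_zb.1 hs
    simp only [zb, Prod.fst_sub, Prod.snd_sub] at h1 h2
    exact hn (hμ.mem_of_le h5 (by omega) (by omega))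
  rw [polOrder_TM_star_eq_corners hμ, he, Finset.card_empty]
  split_ifs <;> omega

/-- Bounds on the pole order of `T_{μ*ν}`; in particular every pole is
simple. -/
theorem stmt11 (μ ν : Finset Box) (hμ : IsYoung μ) (hν : IsYoung ν) (s : ℤ × ℤ) :
    1 - max ((Outer μ).card : ℤ) ((Outer ν).card : ℤ) ≤ polOrder (TM (star μ ν)) (brk s) ∧
    polOrder (TM (star μ ν)) (brk s) ≤ 1 := by
  refine ⟨?_, polOrder_TM_star_le_one hμ hν s⟩
  by_cases hsν : s ∈ ν.image zb
  · by_cases hsμ : s ∈ μ.image zb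
    · have h1 := neg_one_le_polOrder_of_mem hμ ν s hsμ
      have h2 := one_lt_card_Outer hμ (Finset.image_nonempty.1 ⟨s, hsμ⟩)
      omega
    · have h := one_sub_card_Outer_le_polOrder hν s hsμ
      rw [star_comm] at h
      omega
  · have h := one_sub_card_Outer_le_polOrder hμ s hsν
    omega

end JackLR
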